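/- Let A ⊆ [0,1] be a recursively closed set of irrational numbers: A contains no rational number and there exists a computable function f : ℕ → ℚ × ℚ such that the complement of A in ℝ equals the union over all n ∈ ℕ of the open balls of center (f n).1 and radius (f n).2. Then the set of finite binary words that are not a factor of any Sturmian word with slope in A is computably enumerable: there exists a computable function g : ℕ → Option (List Bool) such that for every finite binary word w (a list over {0,1}), one has (∃ n ∈ ℕ, g(n) = some w) if and only if there are no α ∈ A, ρ ∈ [0,1], and p ∈ ℤ with s_{α,ρ}(p + i) = w(i) for all 0 ≤ i < |w|. -/

import Mathlib

open Classical in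
/-- The Sturmian word of slope `α` and intercept `ρ`: the letter at position `n` is
`0` (i.e. `false`) iff the fractional part of `ρ + n·α` lies in `[0, 1 - α)`. -/
noncomputable def sturmian (α ρ : ℝ) (n : ℤ) : Bool :=
  if Int.fract (ρ + n * α) < 1 - α then false else true


namespace SturmAux

/-- code of a rational in the basic encoding -/
def ratCode (q : ℚ) : ℕ := @Encodable.encode ℚ Rat.instEncodable q

theorem ratCode_eq (q : ℚ) : ratCode q = Nat.pair (Encodable.encode q.num) q.den := by
  rfl

/-- positive part decoded from the code of an integer -/
def posPart (n : ℕ) : ℕ := if n % 2 = 0 then n / 2 else 0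
/-- negative part decoded from the code of an integer -/
def negPart (n : ℕ) : ℕ := if n % 2 = 0 then 0 else n / 2 + 1

theorem encode_ofNat (n : ℕ) : Encodable.encode (n : ℤ) = 2 * n := by rfl
theorem encode_negSucc (n : ℕ) : Encodable.encode (Int.negSucc n) = 2 * n + 1 := by rfl

theorem parts (z : ℤ) : ((posPart (Encodable.encode z) : ℕ) : ℤ) - negPart (Encodable.encode z) = z := by
  cases z with
  | ofNat n =>
    have := encode_ofNat n
    simp only [Int.ofNat_eq_natCast, this, posPart, negPart]
    simp
  | negSucc n =>
    rw [encode_negSucc]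
    have h1 : (2 * n + 1) % 2 = 1 := by omega
    have h2 : (2 * n + 1) / 2 = n := by omega
    simp [posPart, negPart, h1, h2, Int.negSucc_eq]

theorem natAbs_parts (z : ℤ) : posPart (Encodable.encode z) + negPart (Encodable.encode z) = z.natAbs := by
  cases z with
  | ofNat n =>
    have := encode_ofNat n
    simp only [Int.ofNat_eq_natCast, this, posPart, negPart]
    simp
  | negSucc n =>
    rw [encode_negSucc]
    have h1 : (2 * n + 1) % 2 = 1 := by omega
    have h2 : (2 * n + 1) / 2 = n := by omega
    simp [posPart, negPart, h1, h2]

theorem posPart_primrec : Primrec posPart :=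
  Primrec.ite (Primrec.eq.comp (Primrec.nat_mod.comp .id (.const 2)) (.const 0))
    (Primrec.nat_div.comp .id (.const 2)) (.const 0)

theorem negPart_primrec : Primrec negPart :=
  Primrec.ite (Primrec.eq.comp (Primrec.nat_mod.comp .id (.const 2)) (.const 0))
    (.const 0) (Primrec.succ.comp (Primrec.nat_div.comp .id (.const 2)))

/-- decidable description of codes of rationals -/
def IsCode (n : ℕ) : Prop :=
  0 < n.unpair.2 ∧ ∀ k < n.unpair.2 + 1,
    ¬ (1 < k ∧ (posPart n.unpair.1 + negPart n.unpair.1) % k = 0 ∧ n.unpair.2 % k = 0)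

instance : DecidablePred IsCode := fun n => by unfold IsCode; infer_instance

theorem isCode_iff (n : ℕ) : IsCode n ↔ n ∈ Set.range ratCode := by
  constructor
  · rintro ⟨h0, h⟩
    let z : ℤ := Denumerable.ofNat ℤ n.unpair.1
    have hz : Encodable.encode z = n.unpair.1 := Denumerable.encode_ofNat _
    rw [← hz, natAbs_parts] at h
    refine ⟨⟨z, n.unpair.2, h0.ne', ?_⟩, ?_⟩
    · by_contra hc
      have hg : Nat.gcd z.natAbs n.unpair.2 ≠ 1 := hc
      have hpos : 0 < Nat.gcd z.natAbs n.unpair.2 := Nat.gcd_pos_of_pos_right _ h0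
      have hd1 := Nat.gcd_dvd_left z.natAbs n.unpair.2
      have hd2 := Nat.gcd_dvd_right z.natAbs n.unpair.2
      exact h _ (Nat.lt_succ_of_le (Nat.le_of_dvd h0 hd2))
        ⟨by omega, Nat.mod_eq_zero_of_dvd hd1, Nat.mod_eq_zero_of_dvd hd2⟩
    · rw [ratCode_eq]
      simp [hz]
  · rintro ⟨q, rfl⟩
    rw [ratCode_eq]
    unfold IsCode
    simp only [Nat.unpair_pair, natAbs_parts]
    refine ⟨q.pos, ?_⟩
    rintro k - ⟨h1, h2, h3⟩
    have := Nat.dvd_gcd (Nat.dvd_of_mod_eq_zero h2) (Nat.dvd_of_mod_eq_zero h3)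
    rw [q.reduced.gcd_eq_one] at this
    have := Nat.dvd_one.1 this
    omega

theorem isCode_primrec : PrimrecPred IsCode := by
  have hR : PrimrecRel (fun (k n : ℕ) =>
      ¬ (1 < k ∧ (posPart n.unpair.1 + negPart n.unpair.1) % k = 0 ∧ n.unpair.2 % k = 0)) := by
    have h1 : Primrec fun p : ℕ × ℕ => p.2.unpair.1 :=
      Primrec.fst.comp (Primrec.unpair.comp Primrec.snd)
    have h2 : Primrec fun p : ℕ × ℕ => p.2.unpair.2 :=
      Primrec.snd.comp (Primrec.unpair.comp Primrec.snd)
    refine PrimrecPred.not ((Primrec.nat_lt.comp (.const 1) .fst).and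
      (PrimrecPred.and (Primrec.eq.comp (Primrec.nat_mod.comp ?_ .fst) (.const 0))
      (Primrec.eq.comp (Primrec.nat_mod.comp h2 .fst) (.const 0))))
    exact Primrec.nat_add.comp (posPart_primrec.comp h1) (negPart_primrec.comp h1)
  have h2 : Primrec fun p : ℕ => p.unpair.2 :=
      Primrec.snd.comp Primrec.unpair
  exact (Primrec.nat_lt.comp (.const 0) h2).and
    (hR.forall_lt.comp (Primrec.succ.comp h2) .id)

/-- number of codes below `n` -/
def cnt (n : ℕ) : ℕ := ((List.range n).filter (fun k => decide (IsCode k))).length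

theorem cnt_primrec : Primrec cnt :=
  Primrec.list_length.comp ((Primrec.listFilter isCode_primrec).comp Primrec.list_range)

theorem cnt_lt {m n : ℕ} (h : m < n) (hm : IsCode m) : cnt m < cnt n := by
  have h1 : cnt (m + 1) = cnt m + 1 := by
    simp [cnt, List.range_succ, List.filter_append, hm]
  have h2 : ∀ k, cnt (m + 1) ≤ cnt (m + 1 + k) := by
    intro k
    induction k with
    | zero => exact le_rfl
    | succ k ih =>
      refine ih.trans ?_
      rw [← add_assoc]
      simp [cnt, List.range_succ (n := m + 1 + k), List.filter_append]
  have := h2 (n - (m + 1))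
  rw [show m + 1 + (n - (m + 1)) = n by omega] at this
  omega

theorem encode_rat (q : ℚ) : Encodable.encode (self := Primcodable.toEncodable) q = cnt (ratCode q) := by
  have : Encodable.encode (self := Primcodable.toEncodable) q =
    (List.range (ratCode q)).countP (fun y => @decide _ (Encodable.decidableRangeEncode ℚ y)) := by
    rfl
  rw [this, cnt, ← List.countP_eq_length_filter]
  apply List.countP_congr
  intro x _
  simp only [decide_eq_true_eq]
  rw [isCode_iff]
  rfl

theorem ratCode_computable : Computable ratCode := by
  have hp : PrimrecPred (fun p : ℚ × ℕ => IsCode p.2 ∧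
      cnt p.2 = Encodable.encode (self := Primcodable.toEncodable) p.1) :=
    (isCode_primrec.comp .snd).and
      (Primrec.eq.comp (cnt_primrec.comp .snd) (Primrec.encode.comp .fst))
  have hp2 : Primrec₂ (fun (q : ℚ) (n : ℕ) =>
      decide (IsCode n ∧ cnt n = Encodable.encode (self := Primcodable.toEncodable) q)) := hp.decide
  have hpart := Partrec.rfind (p := fun (q : ℚ) (n : ℕ) => Part.some
      (decide (IsCode n ∧ cnt n = Encodable.encode (self := Primcodable.toEncodable) q))) hp2.to_comp
  refine hpart.of_eq_tot fun q => ?_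
  refine Nat.mem_rfind.2 ⟨?_, ?_⟩
  · rw [Part.mem_some_iff, eq_comm, decide_eq_true_eq]
    exact ⟨(isCode_iff _).2 ⟨q, rfl⟩, (encode_rat q).symm⟩
  · intro m hm
    rw [Part.mem_some_iff, eq_comm, decide_eq_false_iff_not]
    rintro ⟨h1, h2⟩
    have := cnt_lt hm h1
    rw [h2, encode_rat] at this
    exact lt_irrefl _ this

/-- numerator (positive part, negative part) and denominator -/
def ratData (q : ℚ) : ℕ × ℕ × ℕ :=
  (posPart (ratCode q).unpair.1, negPart (ratCode q).unpair.1, (ratCode q).unpair.2)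

theorem ratData_computable : Computable ratData := by
  have h : Primrec (fun n : ℕ => (posPart n.unpair.1, negPart n.unpair.1, n.unpair.2)) :=
    (posPart_primrec.comp (Primrec.fst.comp Primrec.unpair)).pair
      ((negPart_primrec.comp (Primrec.fst.comp Primrec.unpair)).pair
        (Primrec.snd.comp Primrec.unpair))
  exact h.to_comp.comp ratCode_computable

theorem ratData_spec (q : ℚ) : 0 < (ratData q).2.2 ∧
    (q : ℝ) = (((ratData q).1 : ℝ) - (ratData q).2.1) / (ratData q).2.2 := by
  simp only [ratData, ratCode_eq, Nat.unpair_pair]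
  refine ⟨q.pos, ?_⟩
  have h := parts q.num
  have h' : ((posPart (Encodable.encode q.num) : ℕ) : ℝ) - negPart (Encodable.encode q.num)
    = (q.num : ℝ) := by exact_mod_cast h
  rw [h', Rat.cast_def]

/-! ### the test -/

/-- number of ones among the first `k` letters -/
def ones (w : List Bool) (k : ℕ) : ℕ :=
  Nat.rec 0 (fun i s => s + (if w[i]? = some true then 1 else 0)) k

theorem ones_succ (w : List Bool) (k : ℕ) :
    ones w (k + 1) = ones w k + (if w[k]? = some true then 1 else 0) := rfl

theorem ones_primrec : Primrec₂ ones := by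
  refine Primrec.nat_rec (f := fun _ : List Bool => 0)
    (g := fun w p => p.2 + (if w[p.1]? = some true then 1 else 0)) (.const 0) ?_
  refine Primrec.nat_add.comp (Primrec.snd.comp .snd) (Primrec.ite (Primrec.eq.comp ?_ (.const _))
    (.const 1) (.const 0))
  exact Primrec.list_getElem?.comp .fst (Primrec.fst.comp .snd)

/-- data of a ball -/
abbrev BD := (ℕ × ℕ × ℕ) × (ℕ × ℕ × ℕ)

/-- The cell `[i/M, (i+1)/M]` lies in the ball `t`. -/
def ballTest (t : BD) (i M : ℕ) : Prop :=
  t.1.1 * t.2.2.2 * M + t.2.2.1 * t.1.2.2 * M <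
    i * t.1.2.2 * t.2.2.2 + t.1.2.1 * t.2.2.2 * M + t.2.1 * t.1.2.2 * M ∧
  (i + 1) * t.1.2.2 * t.2.2.2 + t.1.2.1 * t.2.2.2 * M + t.2.2.1 * t.1.2.2 * M <
    t.1.1 * t.2.2.2 * M + t.2.1 * t.1.2.2 * M

theorem ballTest_iff (c r : ℚ) (i M : ℕ) (hM : 0 < M) :
    ballTest (ratData c, ratData r) i M ↔
      (c : ℝ) - r < i / M ∧ ((i : ℝ) + 1) / M < c + r := by
  obtain ⟨hb, hc⟩ := ratData_spec c
  obtain ⟨hq, hr⟩ := ratData_spec r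
  rw [hc, hr]
  unfold ballTest
  generalize ratData c = C at *
  generalize ratData r = R at *
  obtain ⟨a, a', b⟩ := C
  obtain ⟨p, p', q⟩ := R
  simp only at *
  have hM' : (0 : ℝ) < M := by exact_mod_cast hM
  have hb' : (0 : ℝ) < b := by exact_mod_cast hb
  have hq' : (0 : ℝ) < q := by exact_mod_cast hq
  refine and_congr ?_ ?_
  · rw [← Nat.cast_lt (α := ℝ)]
    push_cast
    rw [div_sub_div _ _ hb'.ne' hq'.ne', div_lt_div_iff₀ (by positivity) hM']
    constructor <;> intro h <;> nlinarith
  · rw [← Nat.cast_lt (α := ℝ)]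
    push_cast
    rw [div_add_div _ _ hb'.ne' hq'.ne', div_lt_div_iff₀ hM' (by positivity)]
    constructor <;> intro h <;> nlinarith

/-- The cell `[i/M, (i+1)/M]` violates the `j, k` constraint. -/
def wordTest (w : List Bool) (j k i M : ℕ) : Prop :=
  k * i + ones w j * M + M < ones w k * M + j * i ∧
  k * (i + 1) + ones w j * M + M < ones w k * M + j * (i + 1)

theorem wordTest_iff (w : List Bool) (j k i M : ℕ) (hM : 0 < M) :
    wordTest w j k i M ↔
      ((k : ℝ) - j) * (i / M) < (ones w k : ℝ) - ones w j - 1 ∧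
      ((k : ℝ) - j) * (((i : ℝ) + 1) / M) < (ones w k : ℝ) - ones w j - 1 := by
  have hM' : (0 : ℝ) < M := by exact_mod_cast hM
  unfold wordTest
  refine and_congr ?_ ?_
  · rw [← Nat.cast_lt (α := ℝ)]
    push_cast
    rw [mul_div_assoc', div_lt_iff₀ hM']
    constructor <;> intro h <;> nlinarith
  · rw [← Nat.cast_lt (α := ℝ)]
    push_cast
    rw [mul_div_assoc', div_lt_iff₀ hM']
    constructor <;> intro h <;> nlinarith

/-- the whole test -/
def test (w : List Bool) (M : ℕ) (l : List BD) : Prop :=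
  0 < M ∧ ∀ i < M, (∃ t ∈ l, ballTest t i M) ∨
    (∃ j < w.length + 1, ∃ k < w.length + 1, wordTest w j k i M)

theorem ballTest_primrec : PrimrecRel (fun (t : BD) (p : ℕ × ℕ) => ballTest t p.1 p.2) := by
  have h11 : Primrec fun x : BD × (ℕ × ℕ) => x.1.1.1 := Primrec.fst.comp (Primrec.fst.comp .fst)
  have h121 : Primrec fun x : BD × (ℕ × ℕ) => x.1.1.2.1 :=
    Primrec.fst.comp (Primrec.snd.comp (Primrec.fst.comp .fst))
  have h122 : Primrec fun x : BD × (ℕ × ℕ) => x.1.1.2.2 :=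
    Primrec.snd.comp (Primrec.snd.comp (Primrec.fst.comp .fst))
  have h21 : Primrec fun x : BD × (ℕ × ℕ) => x.1.2.1 := Primrec.fst.comp (Primrec.snd.comp .fst)
  have h221 : Primrec fun x : BD × (ℕ × ℕ) => x.1.2.2.1 :=
    Primrec.fst.comp (Primrec.snd.comp (Primrec.snd.comp .fst))
  have h222 : Primrec fun x : BD × (ℕ × ℕ) => x.1.2.2.2 :=
    Primrec.snd.comp (Primrec.snd.comp (Primrec.snd.comp .fst))
  have hi : Primrec fun x : BD × (ℕ × ℕ) => x.2.1 := Primrec.fst.comp .snd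
  have hM : Primrec fun x : BD × (ℕ × ℕ) => x.2.2 := Primrec.snd.comp .snd
  have mul3 : ∀ {a b c : BD × (ℕ × ℕ) → ℕ}, Primrec a → Primrec b → Primrec c →
      Primrec (fun x => a x * b x * c x) := fun ha hb hc =>
    Primrec.nat_mul.comp (Primrec.nat_mul.comp ha hb) hc
  refine PrimrecPred.and (Primrec.nat_lt.comp ?_ ?_) (Primrec.nat_lt.comp ?_ ?_)
  · exact Primrec.nat_add.comp (mul3 h11 h222 hM) (mul3 h221 h122 hM)
  · exact Primrec.nat_add.comp (Primrec.nat_add.comp (mul3 hi h122 h222) (mul3 h121 h222 hM))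
      (mul3 h21 h122 hM)
  · exact Primrec.nat_add.comp (Primrec.nat_add.comp (mul3 (Primrec.succ.comp hi) h122 h222)
      (mul3 h121 h222 hM)) (mul3 h221 h122 hM)
  · exact Primrec.nat_add.comp (mul3 h11 h222 hM) (mul3 h21 h122 hM)

theorem wordTest_primrec : PrimrecRel (fun (k : ℕ) (p : ℕ × List Bool × ℕ × ℕ) =>
    wordTest p.2.1 p.1 k p.2.2.1 p.2.2.2) := by
  have hk : Primrec fun x : ℕ × ℕ × List Bool × ℕ × ℕ => x.1 := .fst
  have hj : Primrec fun x : ℕ × ℕ × List Bool × ℕ × ℕ => x.2.1 := Primrec.fst.comp .snd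
  have hw : Primrec fun x : ℕ × ℕ × List Bool × ℕ × ℕ => x.2.2.1 :=
    Primrec.fst.comp (Primrec.snd.comp .snd)
  have hi : Primrec fun x : ℕ × ℕ × List Bool × ℕ × ℕ => x.2.2.2.1 :=
    Primrec.fst.comp (Primrec.snd.comp (Primrec.snd.comp .snd))
  have hM : Primrec fun x : ℕ × ℕ × List Bool × ℕ × ℕ => x.2.2.2.2 :=
    Primrec.snd.comp (Primrec.snd.comp (Primrec.snd.comp .snd))
  have hi1 := Primrec.succ.comp hi
  have hoj := Primrec.nat_mul.comp (ones_primrec.comp hw hj) hM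
  have hok := Primrec.nat_mul.comp (ones_primrec.comp hw hk) hM
  refine PrimrecPred.and (Primrec.nat_lt.comp ?_ ?_) (Primrec.nat_lt.comp ?_ ?_)
  · exact Primrec.nat_add.comp (Primrec.nat_add.comp (Primrec.nat_mul.comp hk hi) hoj) hM
  · exact Primrec.nat_add.comp hok (Primrec.nat_mul.comp hj hi)
  · exact Primrec.nat_add.comp (Primrec.nat_add.comp (Primrec.nat_mul.comp hk hi1) hoj) hM
  · exact Primrec.nat_add.comp hok (Primrec.nat_mul.comp hj hi1)

theorem exists_lt' {β : Type} [Primcodable β] {R : ℕ → β → Prop} (hf : PrimrecRel R) :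
    PrimrecRel fun n y => ∃ x < n, R x y :=
  (hf.exists_mem_list.comp (Primrec.list_range.comp .fst) .snd).of_eq (by simp)

theorem forall_lt' {β : Type} [Primcodable β] {R : ℕ → β → Prop} (hf : PrimrecRel R) :
    PrimrecRel fun n y => ∀ x < n, R x y :=
  (hf.forall_mem_list.comp (Primrec.list_range.comp .fst) .snd).of_eq (by simp)

theorem test_primrec : PrimrecPred (fun x : List Bool × ℕ × List BD => test x.1 x.2.1 x.2.2) := by
  have h1 : PrimrecRel (fun (j : ℕ) (p : List Bool × ℕ × ℕ) =>
      ∃ k < p.1.length + 1, wordTest p.1 j k p.2.1 p.2.2) := by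
    refine PrimrecRel.comp (exists_lt' wordTest_primrec)
      (f := fun x : ℕ × List Bool × ℕ × ℕ => x.2.1.length + 1) (g := fun x => x) ?_ .id
    exact Primrec.succ.comp (Primrec.list_length.comp (Primrec.fst.comp .snd))
  have h2 : PrimrecPred (fun (p : List Bool × ℕ × ℕ) => ∃ j < p.1.length + 1,
      ∃ k < p.1.length + 1, wordTest p.1 j k p.2.1 p.2.2) :=
    PrimrecRel.comp (exists_lt' h1) (Primrec.succ.comp (Primrec.list_length.comp .fst)) .id
  have h3 := ballTest_primrec.exists_mem_list
  have h4 : PrimrecRel (fun (i : ℕ) (x : List Bool × ℕ × List BD) =>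
      (∃ t ∈ x.2.2, ballTest t i x.2.1) ∨
    (∃ j < x.1.length + 1, ∃ k < x.1.length + 1, wordTest x.1 j k i x.2.1)) := by
    have hi : Primrec fun x : ℕ × List Bool × ℕ × List BD => x.1 := .fst
    have hw : Primrec fun x : ℕ × List Bool × ℕ × List BD => x.2.1 := Primrec.fst.comp .snd
    have hM : Primrec fun x : ℕ × List Bool × ℕ × List BD => x.2.2.1 :=
      Primrec.fst.comp (Primrec.snd.comp .snd)
    have hl : Primrec fun x : ℕ × List Bool × ℕ × List BD => x.2.2.2 :=
      Primrec.snd.comp (Primrec.snd.comp .snd)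
    exact PrimrecPred.or (PrimrecRel.comp h3 hl (hi.pair hM))
      (PrimrecPred.comp (f := fun x : ℕ × List Bool × ℕ × List BD => (x.2.1, x.1, x.2.2.1)) h2
        (hw.pair (hi.pair hM)))
  have hM : Primrec fun x : List Bool × ℕ × List BD => x.2.1 := Primrec.fst.comp .snd
  exact PrimrecPred.and (Primrec.nat_lt.comp (.const 0) hM) (PrimrecRel.comp (forall_lt' h4) hM .id)

/-- the first `n` values of `F` -/
def vals {β : Type} (F : ℕ → β) (n : ℕ) : List β :=
  Nat.rec [] (fun i l => F i :: l) n

theorem mem_vals {β : Type} (F : ℕ → β) (n : ℕ) (b : β) : b ∈ vals F n ↔ ∃ i < n, F i = b := by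
  induction n with
  | zero => simp [vals]
  | succ n ih =>
    have : vals F (n + 1) = F n :: vals F n := rfl
    rw [this, List.mem_cons, ih]
    constructor
    · rintro (rfl | ⟨i, hi, rfl⟩)
      · exact ⟨n, by omega, rfl⟩
      · exact ⟨i, by omega, rfl⟩
    · rintro ⟨i, hi, rfl⟩
      rcases Nat.lt_succ_iff_lt_or_eq.1 hi with h | rfl
      · exact Or.inr ⟨i, h, rfl⟩
      · exact Or.inl rfl

theorem vals_computable (F : ℕ → BD) (hF : Computable F) : Computable (vals F) := by
  refine Computable.nat_rec (f := fun n : ℕ => n) (g := fun _ : ℕ => ([] : List BD))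
    (h := fun _ p => F p.1 :: p.2) .id (.const []) ?_
  exact Computable.list_cons.comp (hF.comp (Computable.fst.comp .snd)) (Computable.snd.comp .snd)

theorem enum_generic (b : List Bool × ℕ × ℕ → Bool) (hb : Computable b) :
    ∃ g : ℕ → Option (List Bool), Computable g ∧
      ∀ w, (∃ n, g n = some w) ↔ ∃ M N, b (w, M, N) = true := by
  refine ⟨fun n => (Encodable.decode (α := List Bool × ℕ × ℕ)
    (self := Primcodable.toEncodable) n).bind fun x => bif b x then some x.1 else none, ?_, ?_⟩
  · refine Computable.option_bind Computable.decode ?_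
    exact Computable.cond (hb.comp .snd) (Computable.option_some.comp (Computable.fst.comp .snd))
      (.const none)
  · intro w
    constructor
    · rintro ⟨n, hn⟩
      obtain ⟨⟨v, M, N⟩, -, hx⟩ := Option.bind_eq_some_iff.1 hn
      cases h : b (v, M, N)
      · simp [h] at hx
      · simp [h] at hx
        subst hx
        exact ⟨M, N, h⟩
    · rintro ⟨M, N, h⟩
      refine ⟨Encodable.encode (self := Primcodable.toEncodable) (w, M, N), ?_⟩
      simp only [Encodable.encodek]
      simp [h]

theorem enum_spec (F : ℕ → BD) (hF : Computable F) :
    ∃ g : ℕ → Option (List Bool), Computable g ∧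
      ∀ w, (∃ n, g n = some w) ↔ ∃ M N, test w M (vals F N) := by
  classical
  have ht : Primrec (fun x : List Bool × ℕ × List BD => decide (test x.1 x.2.1 x.2.2)) :=
    test_primrec.decide
  have hx : Computable (fun y : List Bool × ℕ × ℕ => y) := .id
  have hw := Computable.fst.comp hx
  have hM := Computable.fst.comp (Computable.snd.comp hx)
  have hN := Computable.snd.comp (Computable.snd.comp hx)
  have hb := ht.to_comp.comp (hw.pair (hM.pair ((vals_computable F hF).comp hN)))
  obtain ⟨g, hg, h⟩ := enum_generic _ hb
  exact ⟨g, hg, fun w => (h w).trans (by simp)⟩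

/-! ### words -/

theorem floor_step (y α : ℝ) (h0 : 0 ≤ α) (h1 : α ≤ 1) :
    ⌊y + α⌋ = ⌊y⌋ + (if Int.fract y < 1 - α then 0 else 1) := by
  have hf := Int.fract_nonneg y
  have hl := Int.fract_lt_one y
  have he := Int.floor_add_fract y
  split_ifs with h
  · rw [Int.floor_eq_iff]
    push_cast
    constructor <;> linarith
  · rw [Int.floor_eq_iff]
    push_cast
    constructor <;> linarith

theorem factor_iff (α : ℝ) (h0 : 0 ≤ α) (h1 : α ≤ 1) (w : List Bool) :
    (∃ ρ ∈ Set.Icc (0 : ℝ) 1, ∃ p : ℤ,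
      ∀ (i : ℕ) (h : i < w.length), sturmian α ρ (p + i) = w[i]) ↔
    ∀ j < w.length + 1, ∀ k < w.length + 1,
      (ones w k : ℝ) - ones w j - 1 < ((k : ℝ) - j) * α := by
  constructor
  · rintro ⟨ρ, -, p, h⟩
    have key : ∀ k < w.length + 1, ⌊ρ + p * α + k * α⌋ = ⌊ρ + p * α⌋ + ones w k := by
      intro k
      induction k with
      | zero => intro _; simp [ones]
      | succ k ih =>
        intro hk
        have hk' : k < w.length := by omega
        have e := ih (by omega)
        have hs := h k hk'
        rw [ones_succ, List.getElem?_eq_getElem hk', ← hs]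
        have e2 : ρ + p * α + ((k + 1 : ℕ) : ℝ) * α = (ρ + p * α + k * α) + α := by
          push_cast; ring
        rw [e2, floor_step _ _ h0 h1, e]
        have e3 : ρ + ((p + (k : ℤ) : ℤ) : ℝ) * α = ρ + p * α + k * α := by push_cast; ring
        unfold sturmian
        rw [e3]
        by_cases hc : Int.fract (ρ + p * α + k * α) < 1 - α
        · simp [hc]
        · rw [if_neg hc, if_neg hc]
          simp
          ring
    intro j hj k hk
    have ej := Int.lt_floor_add_one (ρ + p * α + j * α)
    have ek := Int.floor_le (ρ + p * α + k * α)
    rw [key j hj] at ej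
    rw [key k hk] at ek
    push_cast at ej ek
    linarith
  · intro h
    obtain ⟨m, hm, hmax⟩ := Finset.exists_max_image (Finset.range (w.length + 1))
      (fun k => (ones w k : ℝ) - k * α) ⟨0, by simp⟩
    set x : ℝ := (ones w m : ℝ) - m * α with hx
    have hlo : ∀ k < w.length + 1, (ones w k : ℝ) ≤ x + k * α := by
      intro k hk
      have := hmax k (Finset.mem_range.2 hk)
      linarith
    have hhi : ∀ k < w.length + 1, x + k * α < ones w k + 1 := by
      intro k hk
      have := h k hk m (Finset.mem_range.1 hm)
      rw [hx]
      linarith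
    have a0 := hlo 0 (by omega)
    have b0 := hhi 0 (by omega)
    have z0 : ones w 0 = 0 := rfl
    rw [z0] at a0 b0
    simp only [Nat.cast_zero, zero_mul, add_zero, zero_add] at a0 b0
    refine ⟨x, ⟨a0, b0.le⟩, 0, ?_⟩
    intro i hi
    have hl := hlo i (by omega)
    have hh := hhi i (by omega)
    have hl1 := hlo (i + 1) (by omega)
    have hh1 := hhi (i + 1) (by omega)
    rw [ones_succ, List.getElem?_eq_getElem hi] at hl1 hh1
    have hfl : ⌊x + i * α⌋ = (ones w i : ℤ) := by
      rw [Int.floor_eq_iff]; push_cast; exact ⟨hl, hh⟩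
    have hfr : Int.fract (x + i * α) = x + i * α - ones w i := by
      rw [Int.fract, hfl]; push_cast; rfl
    unfold sturmian
    have e3 : x + ((0 + (i : ℤ) : ℤ) : ℝ) * α = x + i * α := by push_cast; ring
    rw [e3, hfr]
    cases hw : w[i]
    · rw [hw] at hh1
      simp at hh1
      rw [if_pos (by linarith)]
    · rw [hw] at hl1
      simp at hl1
      rw [if_neg (by linarith)]

theorem lin_between {a x y z b : ℝ} (hx : x ≤ z) (hy : z ≤ y) (h1 : a * x < b) (h2 : a * y < b) :
    a * z < b := by
  rcases le_total 0 a with h | h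
  · exact (mul_le_mul_of_nonneg_left hy h).trans_lt h2
  · exact (mul_le_mul_of_nonpos_left hx h).trans_lt h1

theorem exists_cell (α : ℝ) (h0 : 0 ≤ α) (h1 : α < 1) (M : ℕ) (hM : 0 < M) :
    ∃ i < M, (i : ℝ) / M ≤ α ∧ α ≤ ((i : ℝ) + 1) / M := by
  have hM' : (0 : ℝ) < M := by exact_mod_cast hM
  refine ⟨⌊α * M⌋₊, ?_, ?_, ?_⟩
  · rw [Nat.floor_lt (by positivity)]
    nlinarith
  · rw [div_le_iff₀ hM']
    exact Nat.floor_le (by positivity)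
  · rw [le_div_iff₀ hM']
    exact (Nat.lt_floor_add_one _).le

theorem test_iff (A : Set ℝ)
    (hA : A ⊆ Set.Icc (0 : ℝ) 1) (hirr : ∀ q : ℚ, (q : ℝ) ∉ A) (f : ℕ → ℚ × ℚ)
    (hf : Aᶜ = ⋃ n : ℕ, Metric.ball (((f n).1 : ℝ)) (((f n).2 : ℝ))) (w : List Bool) :
    (∃ M N, test w M (vals (fun n => (ratData (f n).1, ratData (f n).2)) N)) ↔
      ¬ ∃ α ∈ A, ∃ ρ ∈ Set.Icc (0 : ℝ) 1, ∃ p : ℤ,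
            ∀ (i : ℕ) (h : i < w.length), sturmian α ρ (p + i) = w[i] := by
  constructor
  · rintro ⟨M, N, hM, ht⟩ ⟨α, hα, hw⟩
    obtain ⟨h0, h1⟩ := hA hα
    rw [factor_iff α h0 h1] at hw
    have h1' : α < 1 := by
      refine lt_of_le_of_ne h1 ?_
      rintro rfl
      exact hirr 1 (by simpa using hα)
    obtain ⟨i, hi, hc1, hc2⟩ := exists_cell α h0 h1' M hM
    rcases ht i hi with ⟨t, htm, ht⟩ | ⟨j, hj, k, hk, hjk⟩
    · obtain ⟨n, -, rfl⟩ := (mem_vals _ _ _).1 htm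
      rw [ballTest_iff _ _ _ _ hM] at ht
      have : α ∈ Aᶜ := by
        rw [hf]
        refine Set.mem_iUnion.2 ⟨n, ?_⟩
        rw [Metric.mem_ball, Real.dist_eq, abs_lt]
        constructor <;> linarith [ht.1, ht.2]
      exact this hα
    · rw [wordTest_iff _ _ _ _ _ hM] at hjk
      have := lin_between hc1 hc2 hjk.1 hjk.2
      linarith [hw j hj k hk]
  · intro hno
    let U : ℕ ⊕ (ℕ × ℕ) → Set ℝ := fun s => match s with
      | Sum.inl n => Metric.ball (((f n).1 : ℝ)) (((f n).2 : ℝ))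
      | Sum.inr p => {x | p.1 < w.length + 1 ∧ p.2 < w.length + 1 ∧
          ((p.2 : ℝ) - p.1) * x < (ones w p.2 : ℝ) - ones w p.1 - 1}
    have hU : ∀ s, IsOpen (U s) := by
      rintro (n | ⟨j, k⟩)
      · exact Metric.isOpen_ball
      · refine isOpen_const.and (isOpen_const.and ?_)
        exact isOpen_lt (by fun_prop) (by fun_prop)
    have hcov : Set.Icc (0 : ℝ) 1 ⊆ ⋃ s, U s := by
      intro α hα
      by_cases hαA : α ∈ A
      · have hn : ¬ ∀ j < w.length + 1, ∀ k < w.length + 1,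
            (ones w k : ℝ) - ones w j - 1 < ((k : ℝ) - j) * α := by
          rw [← factor_iff α hα.1 hα.2]
          exact fun h => hno ⟨α, hαA, h⟩
        push Not at hn
        obtain ⟨j, hj, k, hk, hle⟩ := hn
        refine Set.mem_iUnion.2 ⟨Sum.inr (j, k), hj, hk, lt_of_le_of_ne hle ?_⟩
        intro he
        by_cases hjk : (k : ℝ) - j = 0
        · have : (k : ℝ) = j := by linarith
          have hkj : k = j := by exact_mod_cast this
          subst hkj
          simp at he
        · apply hirr (((ones w k : ℚ) - ones w j - 1) / ((k : ℚ) - j))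
          push_cast
          simp only at he
          rw [← he, mul_div_cancel_left₀ _ hjk]
          exact hαA
      · have : α ∈ Aᶜ := hαA
        rw [hf] at this
        obtain ⟨n, hn⟩ := Set.mem_iUnion.1 this
        exact Set.mem_iUnion.2 ⟨Sum.inl n, hn⟩
    obtain ⟨δ, hδ, hleb⟩ := lebesgue_number_lemma_of_metric isCompact_Icc hU hcov
    obtain ⟨m, hm⟩ := exists_nat_one_div_lt hδ
    set M := m + 1 with hMdef
    have hM : 0 < M := by omega
    have hM' : (0 : ℝ) < M := by exact_mod_cast hM
    have hm' : 1 / (M : ℝ) < δ := by rw [hMdef]; push_cast; exact hm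
    have hcell : ∀ i : ℕ, ∃ s, i < M → (i : ℝ) / M ∈ U s ∧ ((i : ℝ) + 1) / M ∈ U s := by
      intro i
      by_cases hi : i < M
      · have hi' : (i : ℝ) ≤ M := by exact_mod_cast hi.le
        obtain ⟨s, hs⟩ := hleb ((i : ℝ) / M) ⟨by positivity, by rw [div_le_one hM']; exact hi'⟩
        refine ⟨s, fun _ => ⟨hs (Metric.mem_ball_self hδ), hs ?_⟩⟩
        rw [Metric.mem_ball, Real.dist_eq, ← sub_div, add_sub_cancel_left, abs_of_pos (by positivity)]
        exact hm'
      · exact ⟨Sum.inl 0, fun h => absurd h hi⟩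
    choose s hs using hcell
    let num : ℕ ⊕ (ℕ × ℕ) → ℕ := fun t => match t with
      | Sum.inl n => n
      | Sum.inr _ => 0
    refine ⟨M, (Finset.range M).sup (fun i => num (s i)) + 1, hM, ?_⟩
    intro i hi
    have hsi := hs i hi
    have hle : num (s i) ≤ (Finset.range M).sup (fun i => num (s i)) :=
      Finset.le_sup (f := fun i => num (s i)) (Finset.mem_range.2 hi)
    generalize (Finset.range M).sup (fun i => num (s i)) = N at hle
    generalize s i = t at hsi hle
    rcases t with n | ⟨j, k⟩
    · left
      refine ⟨_, (mem_vals _ _ _).2 ⟨n, Nat.lt_succ_of_le hle, rfl⟩, ?_⟩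
      rw [ballTest_iff _ _ _ _ hM]
      obtain ⟨ha, hb⟩ := hsi
      have ha' : (i : ℝ) / M ∈ Metric.ball (((f n).1 : ℝ)) (((f n).2 : ℝ)) := ha
      have hb' : ((i : ℝ) + 1) / M ∈ Metric.ball (((f n).1 : ℝ)) (((f n).2 : ℝ)) := hb
      rw [Metric.mem_ball, Real.dist_eq, abs_lt] at ha' hb'
      constructor <;> linarith [ha'.1, hb'.2]
    · right
      obtain ⟨⟨hj, hk, ha⟩, ⟨-, -, hb⟩⟩ := hsi
      refine ⟨j, hj, k, hk, ?_⟩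
      rw [wordTest_iff _ _ _ _ _ hM]
      exact ⟨ha, hb⟩

end SturmAux

/-- Given a recursively closed set `A ⊆ [0,1]` of irrational numbers, the set of finite
binary words that are not a factor of any Sturmian word with slope in `A` is
computably enumerable. -/
theorem forbidden_factors_computably_enumerable (A : Set ℝ)
    (hA : A ⊆ Set.Icc (0 : ℝ) 1) (hirr : ∀ q : ℚ, (q : ℝ) ∉ A)
    (hrec : ∃ f : ℕ → ℚ × ℚ, Computable f ∧
      Aᶜ = ⋃ n : ℕ, Metric.ball (((f n).1 : ℝ)) (((f n).2 : ℝ))) :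
    ∃ g : ℕ → Option (List Bool), Computable g ∧
      ∀ w : List Bool, (∃ n : ℕ, g n = some w) ↔
        ¬ ∃ α ∈ A, ∃ ρ ∈ Set.Icc (0 : ℝ) 1, ∃ p : ℤ,
            ∀ (i : ℕ) (h : i < w.length), sturmian α ρ (p + i) = w[i] := by
  obtain ⟨f, hfc, hf⟩ := hrec
  have hF : Computable (fun n => (SturmAux.ratData (f n).1, SturmAux.ratData (f n).2)) :=
    (SturmAux.ratData_computable.comp (Computable.fst.comp hfc)).pair
      (SturmAux.ratData_computable.comp (Computable.snd.comp hfc))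
  obtain ⟨g, hg, h⟩ := SturmAux.enum_spec _ hF
  exact ⟨g, hg, fun w => (h w).trans (SturmAux.test_iff A hA hirr f hf w)⟩
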